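/- Let η be any ball configuration. Then for every k ∈ ℕ and x ∈ ℤ_{≥0}, (Tξ)_k(x) − ξ_k(x) ≥ 0, where (Tξ)_k is the function ξ_k computed from the time-evolved configuration Tη. Moreover, if η↓_ℓ(x) = 1 for some ℓ ≥ k, then (Tξ)_k(x) − ξ_k(x) = k. -/

import Mathlib

open Finset

namespace BBS

attribute [local instance] Classical.propDecidable

noncomputable section

/-- A ball configuration: `η x ∈ {0,1}`; the sites are `x = 1, 2, ...` and
the index `0` is never used. -/
def IsConf (η : ℕ → ℤ) : Prop := ∀ x, η x = 0 ∨ η x = 1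

/-- The carrier with seat numbers: `W η x k = 𝒲_k(x)` (seats `k = 1, 2, ...`). -/
def W (η : ℕ → ℤ) : ℕ → ℕ → ℤ
  | 0 => fun _ => 0
  | x + 1 => fun k =>
      W η x k
        + η (x + 1) * (1 - W η x k) * ∏ ℓ ∈ Finset.Icc 1 (k - 1), W η x ℓ
        - (1 - η (x + 1)) * W η x k * ∏ ℓ ∈ Finset.Icc 1 (k - 1), (1 - W η x ℓ)

/-- The seat number configuration `η↑_k(x)`. -/
def up (η : ℕ → ℤ) (k x : ℕ) : ℤ :=
  η x * (1 - W η (x - 1) k) * ∏ ℓ ∈ Finset.Icc 1 (k - 1), W η (x - 1) ℓ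

/-- The seat number configuration `η↓_k(x)`. -/
def down (η : ℕ → ℤ) (k x : ℕ) : ℤ :=
  (1 - η x) * W η (x - 1) k * ∏ ℓ ∈ Finset.Icc 1 (k - 1), (1 - W η (x - 1) ℓ)

/-- The record indicator `r(x) = 1 - ∑_{k ∈ ℕ} (η↑_k(x) + η↓_k(x))`. -/
def rcd (η : ℕ → ℤ) (x : ℕ) : ℤ :=
  1 - ∑' k : ℕ, if 1 ≤ k then up η k x + down η k x else 0

/-- `m^σ_k(x) = ∑_{y=1}^x (η^σ_k(y) - η^σ_{k+1}(y))`, generic in the seat family `e`. -/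
def mSeq (e : ℕ → ℕ → ℤ) (k x : ℕ) : ℤ :=
  ∑ y ∈ Finset.Icc 1 x, (e k y - e (k + 1) y)

/-- `m↑_k(x)` -/
def mUp (η : ℕ → ℤ) : ℕ → ℕ → ℤ := mSeq (up η)

/-- `m↓_k(x)` -/
def mDown (η : ℕ → ℤ) : ℕ → ℕ → ℤ := mSeq (down η)

/-- `ξ_k(x) = x - ∑_{ℓ=1}^k ∑_{y=1}^x (η↑_ℓ(y) + η↓_ℓ(y))`. -/
def xi (η : ℕ → ℤ) (k x : ℕ) : ℤ :=
  (x : ℤ) - ∑ ℓ ∈ Finset.Icc 1 k, ∑ y ∈ Finset.Icc 1 x, (up η ℓ y + down η ℓ y)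

/-- `{x : m↑_k(x) ≥ j ∧ m↓_k(x) ≥ j}`; `τ_k(j) < ∞` iff this set is nonempty. -/
def tauSet (η : ℕ → ℤ) (k j : ℕ) : Set ℕ :=
  {x : ℕ | (j : ℤ) ≤ mUp η k x ∧ (j : ℤ) ≤ mDown η k x}

/-- `τ_k(j)` (with junk value `0` when `τ_k(j) = ∞`). -/
def tau (η : ℕ → ℤ) (k j : ℕ) : ℕ := sInf (tauSet η k j)

/-- `ζ_k(i)`, the number of `j` with `τ_k(j) < ∞` at effective position `ξ_k(τ_k(j)) = i`. -/
def zeta (η : ℕ → ℤ) (k : ℕ) (i : ℤ) : ℕ :=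
  Set.ncard {j : ℕ | 1 ≤ j ∧ (tauSet η k j).Nonempty ∧ xi η k (tau η k j) = i}

/-- `{x : ξ_k(x) = i}`; `s_k(i) < ∞` iff this set is nonempty. -/
def sSet (η : ℕ → ℤ) (k : ℕ) (i : ℤ) : Set ℕ := {x : ℕ | xi η k x = i}

/-- `s_k(i)` (with junk value `0` when `s_k(i) = ∞`). -/
def sPos (η : ℕ → ℤ) (k : ℕ) (i : ℤ) : ℕ := sInf (sSet η k i)

/-- The carrier with infinite capacity: `carrier η x = W_∞(x)`. -/
def carrier (η : ℕ → ℤ) : ℕ → ℤ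
  | 0 => 0
  | x + 1 => carrier η x + η (x + 1) - min (1 - η (x + 1)) (carrier η x)

/-- The BBS time evolution `T`. -/
def Tev (η : ℕ → ℤ) (x : ℕ) : ℤ := η x + carrier η (x - 1) - carrier η x

/-- The carrier with capacity `c ∈ ℕ ∪ {∞}`. -/
def carrierC (c : ℕ∞) (η : ℕ → ℤ) : ℕ → ℤ
  | 0 => 0
  | x + 1 =>
      carrierC c η x
        + (if c = ⊤ then η (x + 1)
            else min (η (x + 1)) (((c.toNat : ℕ) : ℤ) - carrierC c η x))
        - min (1 - η (x + 1)) (carrierC c η x)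

/-- The BBS time evolution `T_ℓ` with carrier capacity `ℓ = c`. -/
def TevC (c : ℕ∞) (η : ℕ → ℤ) (x : ℕ) : ℤ :=
  η x + carrierC c η (x - 1) - carrierC c η x

/-- `p^σ_k(x) = x - 2 ∑_{ℓ=1}^k ∑_{y=1}^x η^σ_ℓ(y)`, generic in the seat family `e`. -/
def pSeat (e : ℕ → ℕ → ℤ) (k x : ℕ) : ℤ :=
  (x : ℤ) - 2 * ∑ ℓ ∈ Finset.Icc 1 k, ∑ y ∈ Finset.Icc 1 x, e ℓ y

/-- `t^σ_k(x,j) = max{1 ≤ y ≤ x : m^σ_k(y) = j, η^σ_k(y) = 1}`. -/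
def tmax (e : ℕ → ℕ → ℤ) (k x : ℕ) (j : ℤ) : ℕ :=
  sSup {y : ℕ | 1 ≤ y ∧ y ≤ x ∧ mSeq e k y = j ∧ e k y = 1}

/-- The largest entry of a multiset of integers (junk for the empty multiset). -/
def maxE (s : Multiset ℤ) : ℤ := sSup {a : ℤ | a ∈ s}

/-- The refined rigging algorithm: `rigSeq e x k` is the multiset of entries of the
array `J^σ_k(x)`, where `e = η^σ`. -/
def rigSeq (e : ℕ → ℕ → ℤ) : ℕ → ℕ → Multiset ℤ
  | 0 => fun _ => 0
  | x + 1 =>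
      let J := rigSeq e x
      let k1 := sSup {k : ℕ | 1 ≤ k ∧ e k (x + 1) = 1}
      if k1 = 0 then J
      else fun j =>
        if j = k1 then pSeat e k1 (x + 1) ::ₘ J j
        else if 1 ≤ j ∧ j + 1 = k1 then (J j).erase (maxE (J j))
        else J j

/-- The KKR algorithm: `kkr η x k` is the multiset of rigging entries attached to the
rows of length `k` of the rigged partition `(μ(x), J(x))`. -/
def kkr (η : ℕ → ℤ) : ℕ → ℕ → Multiset ℤ
  | 0 => fun _ => 0
  | x + 1 =>
      let R := kkr η x
      if η (x + 1) = 1 then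
        -- the vacancy `p_k(x)` of the current rigged partition
        let p : ℕ → ℤ := fun k =>
          (x : ℤ) - 2 * ∑' j : ℕ, ((R j).card : ℤ) * min (j : ℤ) (k : ℤ)
        -- the maximal length of a singular row (`0` if there is none)
        let k0 : ℕ := sSup {k : ℕ | 1 ≤ k ∧ p k ∈ R k ∧ ∀ a ∈ R k, a ≤ p k}
        -- the multiplicities of the new partition `μ(x+1)`
        let m' : ℕ → ℤ := fun j =>
          ((R j).card : ℤ) + (if j = k0 + 1 then 1 else 0) - (if 1 ≤ j ∧ j = k0 then 1 else 0)
        -- the vacancy `p_{k0+1}(x+1)` of the new rigged partition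
        let p' : ℤ := ((x : ℤ) + 1) - 2 * ∑' j : ℕ, m' j * min (j : ℤ) ((k0 : ℤ) + 1)
        fun k =>
          if k = k0 + 1 then p' ::ₘ R k
          else if k = k0 then (R k).erase (p k0)
          else R k
      else R

/-- The conjugate partition `λ_k(x)` of `μ(x)` in the KKR algorithm. -/
def lamKKR (η : ℕ → ℤ) (k x : ℕ) : ℤ :=
  ∑' j : ℕ, if k ≤ j then ((kkr η x j).card : ℤ) else 0

/-- The vacancy `p_k(x) = x - 2 ∑_i min{μ_i(x), k}` in the KKR algorithm. -/
def pKKR (η : ℕ → ℤ) (k x : ℕ) : ℤ :=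
  (x : ℤ) - 2 * ∑' j : ℕ, ((kkr η x j).card : ℤ) * min (j : ℤ) (k : ℤ)

/-! Interlacing Young diagrams.  A Young diagram is encoded as the multiset of its
(positive) row lengths. -/

/-- The conjugate partition: `conj μ k = λ_k`, the number of rows of length `≥ k`. -/
def conj (μ : Multiset ℕ) (k : ℕ) : ℕ := (μ.filter (fun r => k ≤ r)).card

/-- `(μ↑, μ↓)` is interlacing: `μ↑_1 ≥ μ↓_1 ≥ μ↑_2 ≥ μ↓_2 ≥ ⋯`, equivalently
`λ↑_k − λ↓_k ∈ {0,1}` for all `k ≥ 1`. -/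
def Interlacing (a b : Multiset ℕ) : Prop :=
  ∀ k, 1 ≤ k → conj b k ≤ conj a k ∧ conj a k ≤ conj b k + 1

/-- `{k ≥ 1 : λ↑_ℓ − λ↓_ℓ = 1 for all 1 ≤ ℓ ≤ k}`. -/
def kUpSet (a b : Multiset ℕ) : Set ℕ :=
  {k : ℕ | 1 ≤ k ∧ ∀ ℓ, 1 ≤ ℓ → ℓ ≤ k → conj a ℓ = conj b ℓ + 1}

/-- `{k ≥ 1 : λ↑_ℓ − λ↓_ℓ = 0 for all 1 ≤ ℓ ≤ k}`. -/
def kDownSet (a b : Multiset ℕ) : Set ℕ :=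
  {k : ℕ | 1 ≤ k ∧ ∀ ℓ, 1 ≤ ℓ → ℓ ≤ k → conj a ℓ = conj b ℓ}

/-- `k↑` (with `sup ∅ = 0`). -/
def kUp (a b : Multiset ℕ) : ℕ := sSup (kUpSet a b)

/-- `k↓` (with `sup ∅ = 0`; junk value `0` also when `k↓ = ∞`, i.e. `μ↑ = μ↓`). -/
def kDown (a b : Multiset ℕ) : ℕ := sSup (kDownSet a b)

/-- Add one box to a row of length `k` (a new row of length `1` is added if `k = 0`). -/
def addBox (μ : Multiset ℕ) (k : ℕ) : Multiset ℕ := (k + 1) ::ₘ μ.erase k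

/-- The interlacing-diagrams algorithm producing `(μ↑(x), μ↓(x))`. -/
def ydPair (η : ℕ → ℤ) : ℕ → Multiset ℕ × Multiset ℕ
  | 0 => (0, 0)
  | x + 1 =>
      let P := ydPair η x
      if η (x + 1) = 1 then (addBox P.1 (kUp P.1 P.2), P.2)
      else if P.1 ≠ P.2 then (P.1, addBox P.2 (kDown P.1 P.2))
      else P

/-! The Takahashi–Satsuma algorithm and the slot configuration.  The state of the
algorithm is the set `C` of crossed-out sites. -/

/-- The sites not yet crossed out. -/
def active (C : Set ℕ) : Set ℕ := {x | 1 ≤ x ∧ x ∉ C}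

/-- The maximal run (of consecutive equal letters among uncrossed sites) containing `x`. -/
def runOf (η : ℕ → ℤ) (C : Set ℕ) (x : ℕ) : Set ℕ :=
  {y | x ∈ active C ∧ y ∈ active C ∧
    ∀ z ∈ active C, min x y ≤ z → z ≤ max x y → η z = η x}

/-- The length of the run containing `x`, in `ℕ∞`. -/
def runLen (η : ℕ → ℤ) (C : Set ℕ) (x : ℕ) : ℕ∞ :=
  if (runOf η C x).Infinite then ⊤ else ((runOf η C x).ncard : ℕ∞)

/-- The first sites of runs qualifying for the TS step: the run has a preceding run and
is at least as long as it. -/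
def qualSet (η : ℕ → ℤ) (C : Set ℕ) : Set ℕ :=
  {b | b ∈ active C ∧ sInf (runOf η C b) = b ∧
    {y ∈ active C | y < b}.Nonempty ∧
    runLen η C (sSup {y ∈ active C | y < b}) ≤ runLen η C b}

/-- The first site of the leftmost qualifying run. -/
def bSel (η : ℕ → ℤ) (C : Set ℕ) : ℕ := sInf (qualSet η C)

/-- The last site of the run preceding the selected run. -/
def prevSel (η : ℕ → ℤ) (C : Set ℕ) : ℕ :=
  sSup {y ∈ active C | y < bSel η C}

/-- The last `k` letters of the preceding run (the whole preceding run, whose length is `k`). -/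
def S1 (η : ℕ → ℤ) (C : Set ℕ) : Set ℕ := runOf η C (prevSel η C)

/-- The first `k` letters of the selected run. -/
def S2 (η : ℕ → ℤ) (C : Set ℕ) : Set ℕ :=
  {y ∈ runOf η C (bSel η C) |
    ({z ∈ runOf η C (bSel η C) | z ≤ y}).ncard ≤ (S1 η C).ncard}

/-- One step of the TS algorithm: cross out the identified soliton (if any run qualifies). -/
def tsStep (η : ℕ → ℤ) (C : Set ℕ) : Set ℕ :=
  if (qualSet η C).Nonempty then C ∪ S1 η C ∪ S2 η C else C

/-- The crossed-out sites after `n` steps of the TS algorithm. -/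
def tsC (η : ℕ → ℤ) : ℕ → Set ℕ
  | 0 => ∅
  | n + 1 => tsStep η (tsC η n)

/-- The slot configuration `ν : ℕ → ℤ_{≥0} ∪ {∞}`: for a `k`-soliton
`γ = {z_1 < ⋯ < z_{2k}}`, `ν(z_l) = ν(z_{l+k}) = l − 1`, and `ν(x) = ∞` for records. -/
def nuTS (η : ℕ → ℤ) (z : ℕ) : ℕ∞ :=
  if _h : ∃ n, z ∈ tsC η (n + 1) ∧ z ∉ tsC η n then
    let n := sInf {n : ℕ | z ∈ tsC η (n + 1) ∧ z ∉ tsC η n}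
    if z ∈ S1 η (tsC η n) then (({w ∈ S1 η (tsC η n) | w < z}).ncard : ℕ∞)
    else (({w ∈ S2 η (tsC η n) | w < z}).ncard : ℕ∞)
  else ⊤

/-- `ξ̃_k(x)`, the number of `k`-slots in `[1,x]`. -/
def xiTS (η : ℕ → ℤ) (k x : ℕ) : ℕ :=
  Set.ncard {y : ℕ | 1 ≤ y ∧ y ≤ x ∧ (k : ℕ∞) ≤ nuTS η y}

/-- `s̃_k(i)`, the position of the `i`-th `k`-slot. -/
def sTS (η : ℕ → ℤ) (k i : ℕ) : ℕ := sInf {x : ℕ | xiTS η k x = i}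

/-- The slot decomposition `ζ̃_k(i)`: the number of `k`-solitons appended to the
`i`-th `k`-slot. -/
def zetaTS (η : ℕ → ℤ) (k i : ℕ) : ℕ :=
  Set.ncard {n : ℕ | (qualSet η (tsC η n)).Nonempty ∧ (S1 η (tsC η n)).ncard = k ∧
    ∀ z ∈ S1 η (tsC η n) ∪ S2 η (tsC η n), sTS η k i ≤ z ∧ z ≤ sTS η k (i + 1) - 1}

end

end BBS

namespace BBS

variable {η : ℕ → ℤ} {x ℓ : ℕ}

lemma W_succ (η : ℕ → ℤ) (x k : ℕ) :
    W η (x + 1) k = W η x k + up η k (x + 1) - down η k (x + 1) := rfl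

lemma xi_succ (η : ℕ → ℤ) (k x : ℕ) :
    xi η k (x + 1) = xi η k x + 1 - ∑ i ∈ Icc 1 k, (up η i (x + 1) + down η i (x + 1)) := by
  have h : ∀ i, ∑ y ∈ Icc 1 (x + 1), (up η i y + down η i y)
      = ∑ y ∈ Icc 1 x, (up η i y + down η i y) + (up η i (x + 1) + down η i (x + 1)) :=
    fun i => Finset.sum_Icc_succ_top (by omega) _
  simp only [xi, h, Finset.sum_add_distrib]
  push_cast
  ring

lemma down_eq_zero_of_ball (h : η x = 1) (k : ℕ) : down η k x = 0 := by
  simp [down, h]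

lemma up_eq_zero_of_empty (h : η x = 0) (k : ℕ) : up η k x = 0 := by
  simp [up, h]

/-- An arriving ball takes the first empty seat. -/
lemma up_eq_ite (h : η (x + 1) = 1) (hℓ : 1 ≤ ℓ) (h0 : W η x ℓ = 0)
    (h1 : ∀ j, 1 ≤ j → j < ℓ → W η x j = 1) (k : ℕ) (hk : 1 ≤ k) :
    up η k (x + 1) = if k = ℓ then 1 else 0 := by
  simp only [up, h, Nat.add_sub_cancel]
  rcases lt_trichotomy k ℓ with hlt | rfl | hgt
  · simp [h1 k hk hlt, hlt.ne]
  · have : ∏ j ∈ Icc 1 (k - 1), W η x j = 1 :=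
      Finset.prod_eq_one fun j hj => by
        rw [Finset.mem_Icc] at hj
        exact h1 j hj.1 (by omega)
    simp [h0, this]
  · have : ∏ j ∈ Icc 1 (k - 1), W η x j = 0 :=
      Finset.prod_eq_zero (i := ℓ) (by rw [Finset.mem_Icc]; omega) h0
    simp [this, hgt.ne']

/-- At an empty site, the first occupied seat is vacated. -/
lemma down_eq_ite (h : η (x + 1) = 0) (hℓ : 1 ≤ ℓ) (h1 : W η x ℓ = 1)
    (h0 : ∀ j, 1 ≤ j → j < ℓ → W η x j = 0) (k : ℕ) (hk : 1 ≤ k) :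
    down η k (x + 1) = if k = ℓ then 1 else 0 := by
  simp only [down, h, Nat.add_sub_cancel]
  rcases lt_trichotomy k ℓ with hlt | rfl | hgt
  · simp [h0 k hk hlt, hlt.ne]
  · have : ∏ j ∈ Icc 1 (k - 1), (1 - W η x j) = 1 :=
      Finset.prod_eq_one fun j hj => by
        rw [Finset.mem_Icc] at hj
        simp [h0 j hj.1 (by omega)]
    simp [h1, this]
  · have : ∏ j ∈ Icc 1 (k - 1), (1 - W η x j) = 0 :=
      Finset.prod_eq_zero (i := ℓ) (by rw [Finset.mem_Icc]; omega) (by simp [h1])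
    simp [this, hgt.ne']

lemma down_eq_zero_of_W_eq_zero {k : ℕ} (h : W η x k = 0) : down η k (x + 1) = 0 := by
  simp [down, h]

/-- A nonempty set of positive integers has a least element. -/
lemma exists_first {p : ℕ → Prop} (h : ∃ k, 1 ≤ k ∧ p k) :
    ∃ ℓ, 1 ≤ ℓ ∧ p ℓ ∧ ∀ j, 1 ≤ j → j < ℓ → ¬ p j := by
  classical
  exact ⟨Nat.find h, (Nat.find_spec h).1, (Nat.find_spec h).2,
    fun j hj hlt hp => Nat.find_min h hlt ⟨hj, hp⟩⟩

lemma sum_indicator (k : ℕ) (hℓ : 1 ≤ ℓ) :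
    ∑ i ∈ Icc 1 k, (if i = ℓ then (1 : ℤ) else 0) = if ℓ ≤ k then 1 else 0 := by
  simp [hℓ]

/-- The seats are `{0,1}`-valued, finitely many are occupied, and their total occupation is the
load of the infinite-capacity carrier. -/
lemma carrier_eq_sum_W (hη : IsConf η) (x : ℕ) :
    (∀ k, 1 ≤ k → W η x k = 0 ∨ W η x k = 1) ∧ (∀ k, x < k → W η x k = 0) ∧
      ∀ N, x ≤ N → carrier η x = ∑ k ∈ Icc 1 N, W η x k := by
  induction x with
  | zero => simp [W, carrier]
  | succ x ih =>
    obtain ⟨hW, hsupp, hsum⟩ := ih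
    have hc : 0 ≤ carrier η x := by
      rw [hsum x le_rfl]
      refine Finset.sum_nonneg fun k hk => ?_
      rcases hW k (Finset.mem_Icc.1 hk).1 with h | h <;> simp [h]
    rcases hη (x + 1) with he | he
    · have hup := up_eq_zero_of_empty he
      by_cases hex : ∃ k, 1 ≤ k ∧ W η x k = 1
      · obtain ⟨ℓ, hℓ, h1, hlt⟩ := exists_first hex
        have h0 : ∀ j, 1 ≤ j → j < ℓ → W η x j = 0 := fun j hj hl =>
          (hW j hj).resolve_right (hlt j hj hl)
        have hd := down_eq_ite he hℓ h1 h0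
        have hℓx : ℓ ≤ x := by
          by_contra hn
          have := hsupp ℓ (by omega)
          omega
        have hs : ∀ k, 1 ≤ k → W η (x + 1) k = W η x k - if k = ℓ then 1 else 0 := by
          intro k hk
          rw [W_succ, hup, hd k hk]; ring
        refine ⟨fun k hk => ?_, fun k hk => ?_, fun N hN => ?_⟩
        · rw [hs k hk]
          split_ifs with hkl
          · subst hkl; simp [h1]
          · simpa using hW k hk
        · rw [hs k (by omega), hsupp k (by omega), if_neg (by omega)]; rfl
        · rw [Finset.sum_congr rfl fun k hk => hs k (Finset.mem_Icc.1 hk).1,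
            Finset.sum_sub_distrib, sum_indicator N hℓ, if_pos (by omega), ← hsum N (by omega)]
          have hpos : 1 ≤ carrier η x := by
            rw [hsum x le_rfl, ← h1]
            refine Finset.single_le_sum (f := fun k => W η x k) (fun k hk => ?_)
              (Finset.mem_Icc.2 ⟨hℓ, hℓx⟩)
            rcases hW k (Finset.mem_Icc.1 hk).1 with h | h <;> simp [h]
          rw [carrier, he]
          omega
      · have h0 : ∀ k, 1 ≤ k → W η x k = 0 := fun k hk =>
          (hW k hk).resolve_right fun h => hex ⟨k, hk, h⟩
        have hs : ∀ k, 1 ≤ k → W η (x + 1) k = 0 := by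
          intro k hk
          rw [W_succ, hup, down_eq_zero_of_W_eq_zero (h0 k hk), h0 k hk]; rfl
        have hc0 : carrier η x = 0 := by
          rw [hsum x le_rfl]
          exact Finset.sum_eq_zero fun k hk => h0 k (Finset.mem_Icc.1 hk).1
        refine ⟨fun k hk => .inl (hs k hk), fun k hk => hs k (by omega), fun N hN => ?_⟩
        rw [Finset.sum_eq_zero fun k hk => hs k (Finset.mem_Icc.1 hk).1, carrier, he, hc0]
        rfl
    · obtain ⟨ℓ, hℓ, h0, hlt⟩ := exists_first (p := fun k => W η x k = 0)
        ⟨x + 1, by omega, hsupp _ (by omega)⟩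
      have h1 : ∀ j, 1 ≤ j → j < ℓ → W η x j = 1 := fun j hj hl =>
        (hW j hj).resolve_left (hlt j hj hl)
      have hu := up_eq_ite he hℓ h0 h1
      have hℓx : ℓ ≤ x + 1 := by
        by_contra hn
        exact hlt (x + 1) (by omega) (by omega) (hsupp _ (by omega))
      have hs : ∀ k, 1 ≤ k → W η (x + 1) k = W η x k + if k = ℓ then 1 else 0 := by
        intro k hk
        rw [W_succ, down_eq_zero_of_ball he, hu k hk]; ring
      refine ⟨fun k hk => ?_, fun k hk => ?_, fun N hN => ?_⟩
      · rw [hs k hk]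
        split_ifs with hkl
        · subst hkl; simp [h0]
        · simpa using hW k hk
      · rw [hs k (by omega), hsupp k (by omega), if_neg (by omega)]; rfl
      · rw [Finset.sum_congr rfl fun k hk => hs k (Finset.mem_Icc.1 hk).1,
          Finset.sum_add_distrib, sum_indicator N hℓ, if_pos (by omega), ← hsum N (by omega),
          carrier, he]
        omega

lemma carrier_nonneg (hη : IsConf η) (x : ℕ) : 0 ≤ carrier η x := by
  obtain ⟨hW, -, hsum⟩ := carrier_eq_sum_W hη x
  rw [hsum x le_rfl]
  refine Finset.sum_nonneg fun k hk => ?_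
  rcases hW k (Finset.mem_Icc.1 hk).1 with h | h <;> simp [h]

lemma exists_first_empty (hη : IsConf η) (x : ℕ) :
    ∃ ℓ, 1 ≤ ℓ ∧ W η x ℓ = 0 ∧ ∀ j, 1 ≤ j → j < ℓ → W η x j = 1 := by
  obtain ⟨hW, hsupp, -⟩ := carrier_eq_sum_W hη x
  obtain ⟨ℓ, hℓ, h0, hlt⟩ := exists_first (p := fun k => W η x k = 0)
    ⟨x + 1, by omega, hsupp _ (by omega)⟩
  exact ⟨ℓ, hℓ, h0, fun j hj hl => (hW j hj).resolve_left (hlt j hj hl)⟩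

lemma Tev_of_ball (hη : IsConf η) (h : η (x + 1) = 1) : Tev η (x + 1) = 0 := by
  have := carrier_nonneg hη x
  simp only [Tev, Nat.add_sub_cancel, carrier, h]
  omega

lemma Tev_of_occupied (hη : IsConf η) (h : η (x + 1) = 0) (hℓ : 1 ≤ ℓ) (h1 : W η x ℓ = 1) :
    Tev η (x + 1) = 1 := by
  obtain ⟨hW, -, hsum⟩ := carrier_eq_sum_W hη x
  have hpos : 1 ≤ carrier η x := by
    rw [hsum (max x ℓ) (le_max_left _ _), ← h1]
    refine Finset.single_le_sum (f := fun k => W η x k) (fun k hk => ?_)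
      (Finset.mem_Icc.2 ⟨hℓ, le_max_right _ _⟩)
    rcases hW k (Finset.mem_Icc.1 hk).1 with h | h <;> simp [h]
  simp only [Tev, Nat.add_sub_cancel, carrier, h]
  omega

lemma Tev_of_record (hη : IsConf η) (h : η (x + 1) = 0) (h0 : ∀ k, 1 ≤ k → W η x k = 0) :
    Tev η (x + 1) = 0 := by
  have hc : carrier η x = 0 := by
    rw [(carrier_eq_sum_W hη x).2.2 x le_rfl]
    exact Finset.sum_eq_zero fun k hk => h0 k (Finset.mem_Icc.1 hk).1
  simp [Tev, carrier, h, hc]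

/-- The joint state of the carriers of `η` and `Tη`: no seat is occupied in both, below an
occupied seat of `η` every seat is occupied in exactly one of the two, and the number of seats
among the first `k` that are occupied in either carrier is `Tξ_k - ξ_k`. -/
structure JointState (η : ℕ → ℤ) (x : ℕ) : Prop where
  seat : ∀ k, 1 ≤ k → W η x k = 0 ∨ W η x k = 1
  seatT : ∀ k, 1 ≤ k → W (Tev η) x k = 0 ∨ W (Tev η) x k = 1
  disjoint : ∀ k, 1 ≤ k → W η x k + W (Tev η) x k ≤ 1
  below : ∀ k j, 1 ≤ j → j ≤ k → W η x k = 1 → W η x j + W (Tev η) x j = 1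
  xi_sub : ∀ k, xi (Tev η) k x - xi η k x = ∑ j ∈ Icc 1 k, (W η x j + W (Tev η) x j)

/-- If the carrier of `η` releases a ball from seat `ℓ`, then `Tη` puts one on seat `ℓ`. -/
lemma JointState.up_Tev (hη : IsConf η) (S : JointState η x) (h : η (x + 1) = 0) (hℓ : 1 ≤ ℓ)
    (h1 : W η x ℓ = 1) (h0 : ∀ j, 1 ≤ j → j < ℓ → W η x j = 0) (k : ℕ) (hk : 1 ≤ k) :
    up (Tev η) k (x + 1) = if k = ℓ then 1 else 0 := by
  refine up_eq_ite (Tev_of_occupied hη h hℓ h1) hℓ ?_ (fun j hj hlt => ?_) k hk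
  · have := S.below ℓ ℓ hℓ le_rfl h1
    omega
  · have := S.below ℓ j hj hlt.le h1
    have := h0 j hj hlt
    omega

/-- The `Tη`-carrier at an empty site of `Tη` either is empty or vacates its first seat. -/
lemma down_cases (he : η (x + 1) = 0) (hW : ∀ k, 1 ≤ k → W η x k = 0 ∨ W η x k = 1) :
    (∀ k, 1 ≤ k → W η x k = 0 ∧ down η k (x + 1) = 0) ∨
    ∃ m, 1 ≤ m ∧ W η x m = 1 ∧ (∀ j, 1 ≤ j → j < m → W η x j = 0) ∧
      ∀ k, 1 ≤ k → down η k (x + 1) = if k = m then 1 else 0 := by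
  by_cases hex : ∃ k, 1 ≤ k ∧ W η x k = 1
  · obtain ⟨m, hm, h1, hlt⟩ := exists_first hex
    have h0 : ∀ j, 1 ≤ j → j < m → W η x j = 0 := fun j hj hl =>
      (hW j hj).resolve_right (hlt j hj hl)
    exact .inr ⟨m, hm, h1, h0, down_eq_ite he hm h1 h0⟩
  · refine .inl fun k hk => ?_
    have h0 := (hW k hk).resolve_right fun h => hex ⟨k, hk, h⟩
    exact ⟨h0, down_eq_zero_of_W_eq_zero h0⟩

/-- The identity for `Tξ_k - ξ_k` propagates as soon as, at each seat, up-moves of `Tη` and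
down-moves of `η` agree. -/
lemma xi_sub_succ (h : ∀ k, xi (Tev η) k x - xi η k x = ∑ j ∈ Icc 1 k, (W η x j + W (Tev η) x j))
    (hud : ∀ k, 1 ≤ k → up (Tev η) k (x + 1) = down η k (x + 1)) (k : ℕ) :
    xi (Tev η) k (x + 1) - xi η k (x + 1)
      = ∑ j ∈ Icc 1 k, (W η (x + 1) j + W (Tev η) (x + 1) j) := by
  have e : ∑ j ∈ Icc 1 k, (W η (x + 1) j + W (Tev η) (x + 1) j)
      = ∑ j ∈ Icc 1 k, ((W η x j + W (Tev η) x j) + (up η j (x + 1) + down η j (x + 1))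
          - (up (Tev η) j (x + 1) + down (Tev η) j (x + 1))) :=
    Finset.sum_congr rfl fun j hj => by
      rw [W_succ, W_succ, hud j (Finset.mem_Icc.1 hj).1]; ring
  rw [e, Finset.sum_sub_distrib, Finset.sum_add_distrib, ← h k, xi_succ, xi_succ]
  ring

lemma jointState (hη : IsConf η) (x : ℕ) : JointState η x := by
  induction x with
  | zero => constructor <;> simp [W, xi]
  | succ x S =>
    have hW := (carrier_eq_sum_W hη (x + 1)).1
    have hWs := W_succ η x
    have hTs := W_succ (Tev η) x
    rcases hη (x + 1) with he | he
    · have hup := up_eq_zero_of_empty he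
      rcases down_cases he S.seat with h0 | ⟨ℓ, hℓ, h1, h0, hd⟩
      · have hT := Tev_of_record hη he fun k hk => (h0 k hk).1
        have hupT := up_eq_zero_of_empty hT
        have hzero : ∀ k, 1 ≤ k → W η (x + 1) k = 0 := fun k hk => by
          rw [hWs, hup, (h0 k hk).1, (h0 k hk).2]; rfl
        have hseatT : ∀ k, 1 ≤ k → W (Tev η) (x + 1) k = 0 ∨ W (Tev η) (x + 1) k = 1 := by
          intro k hk
          rcases down_cases hT S.seatT with h | ⟨m, hm, hm1, hm0, hmd⟩
          · simp [hTs, hupT, h k hk]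
          · have := S.seatT k hk
            rw [hTs, hupT, hmd k hk]
            split_ifs with hkm
            · subst hkm; simp [hm1]
            · simpa using this
        refine ⟨hW, hseatT, fun k hk => ?_, fun k j hj hjk h => ?_, xi_sub_succ S.xi_sub ?_⟩
        · have := hseatT k hk
          have := hzero k hk
          omega
        · have := hzero k (by omega)
          omega
        · intro k hk
          rw [hupT, (h0 k hk).2]
      · have hu := S.up_Tev hη he hℓ h1 h0
        have hT := Tev_of_occupied hη he hℓ h1
        have hdT := down_eq_zero_of_ball hT
        have hsum : ∀ k, 1 ≤ k →
            W η (x + 1) k + W (Tev η) (x + 1) k = W η x k + W (Tev η) x k := by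
          intro k hk
          rw [hWs, hTs, hup, hdT, hu k hk, hd k hk]; ring
        refine ⟨hW, fun k hk => ?_, fun k hk => ?_, fun k j hj hjk h => ?_,
          xi_sub_succ S.xi_sub ?_⟩
        · have := S.seatT k hk
          have hb := S.below ℓ ℓ hℓ le_rfl h1
          rw [hTs, hdT, hu k hk]
          split_ifs with hkl
          · subst hkl; omega
          · simpa using this
        · rw [hsum k hk]
          exact S.disjoint k hk
        · rw [hsum j hj]
          refine S.below k j hj hjk ?_
          rw [hWs, hup, hd k (by omega)] at h
          have := S.seat k (by omega)
          split_ifs at h <;> omega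
        · intro k hk
          rw [hu k hk, hd k hk]
    · have hT := Tev_of_ball hη he
      have hdn := down_eq_zero_of_ball he
      have hupT := up_eq_zero_of_empty hT
      obtain ⟨ℓ, hℓ, h0, h1⟩ := exists_first_empty hη x
      have hu := up_eq_ite he hℓ h0 h1
      have hWs' : ∀ k, 1 ≤ k → W η (x + 1) k = W η x k + if k = ℓ then 1 else 0 :=
        fun k hk => by rw [hWs, hdn, hu k hk]; ring
      obtain ⟨d, hTs', hd⟩ : ∃ d : ℕ → ℤ,
          (∀ k, 1 ≤ k → W (Tev η) (x + 1) k = W (Tev η) x k - d k) ∧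
          ((∀ k, 1 ≤ k → W (Tev η) x k = 0 ∧ d k = 0) ∨
            ∃ m, 1 ≤ m ∧ W (Tev η) x m = 1 ∧ (∀ j, 1 ≤ j → j < m → W (Tev η) x j = 0) ∧
              ∀ k, 1 ≤ k → d k = if k = m then 1 else 0) :=
        ⟨fun k => down (Tev η) k (x + 1), fun k _ => by rw [hTs, hupT]; ring,
          down_cases hT S.seatT⟩
      have hlow : ∀ j, 1 ≤ j → j < ℓ → W (Tev η) x j = 0 := fun j hj hl => by
        have := S.disjoint j hj
        have := h1 j hj hl
        have := S.seatT j hj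
        omega
      have hbelow : ∀ k, 1 ≤ k → W η x k = 1 → ℓ < k → W (Tev η) x ℓ = 1 :=
        fun k hk hk1 hl => by
          have := S.below k ℓ hℓ hl.le hk1
          omega
      refine ⟨hW, fun k hk => ?_, fun k hk => ?_, fun k j hj hjk h => ?_,
        xi_sub_succ S.xi_sub fun k hk => by rw [hupT, hdn]⟩
      · have := S.seatT k hk
        rw [hTs' k hk]
        rcases hd with hd | ⟨m, hm, hm1, hm0, hmd⟩
        · have := hd k hk
          omega
        · rw [hmd k hk]
          split_ifs with hkm
          · subst hkm; omega
          · omega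
      · have := S.disjoint k hk
        have := S.seatT k hk
        have := S.seat k hk
        rw [hWs' k hk, hTs' k hk]
        rcases hd with hd | ⟨m, hm, hm1, hm0, hmd⟩
        · have := hd k hk
          split_ifs with hkl
          · subst hkl; omega
          · omega
        · rw [hmd k hk]
          rcases lt_trichotomy k m with hkm | rfl | hkm
          · have := hm0 k hk hkm
            split_ifs with hkl <;> first | omega | (subst hkl; omega)
          · split_ifs with hkl <;> omega
          · have : k = ℓ → False := by
              rintro rfl
              have := hlow m hm hkm
              omega
            rw [if_neg this, if_neg hkm.ne']
            omega
      · rw [hWs' j hj, hTs' j hj]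
        rw [hWs' k (by omega)] at h
        rcases lt_trichotomy j ℓ with hjl | rfl | hjl
        · have e1 := h1 j hj hjl
          have e2 := hlow j hj hjl
          rw [if_neg hjl.ne, e1, e2]
          rcases hd with hd | ⟨m, hm, hm1, hm0, hmd⟩
          · have := hd j hj
            omega
          · rw [hmd j hj, if_neg (by rintro rfl; omega)]; rfl
        · rw [if_pos rfl, h0]
          rcases hd with hd | ⟨m, hm, hm1, hm0, hmd⟩
          · have := hd j hj
            omega
          · rw [hmd j hj]
            have := S.seatT j hj
            rcases lt_trichotomy j m with hjm | rfl | hjm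
            · rw [hm0 j hj hjm, if_neg hjm.ne]; rfl
            · rw [hm1, if_pos rfl]; rfl
            · have := hlow m hm hjm
              omega
        · rw [if_neg (by omega)] at h
          have hk1 : W η x k = 1 := by omega
          have hT1 := hbelow k (by omega) hk1 (by omega)
          have hb := S.below k j hj hjk hk1
          rw [if_neg (by omega)]
          rcases hd with hd | ⟨m, hm, hm1, hm0, hmd⟩
          · have := hd ℓ hℓ
            omega
          · have hml : m ≤ ℓ := by
              by_contra hn
              have := hm0 ℓ hℓ (by omega)
              omega
            rw [hmd j hj, if_neg (by omega)]
            omega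

/-- Lemma 3.10: `Tξ_k(x) − ξ_k(x) ≥ 0`, and if `η↓_ℓ(x) = 1` for some `ℓ ≥ k`
then `Tξ_k(x) − ξ_k(x) = k`. -/
theorem statement10 (η : ℕ → ℤ) (hη : IsConf η) (k : ℕ) (hk : 1 ≤ k) (x : ℕ) :
    0 ≤ xi (Tev η) k x - xi η k x ∧
    (∀ ℓ, k ≤ ℓ → 1 ≤ x → down η ℓ x = 1 → xi (Tev η) k x - xi η k x = (k : ℤ)) := by
  refine ⟨?_, fun ℓ hkℓ hx hdown => ?_⟩
  · have S := jointState hη x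
    rw [S.xi_sub k]
    refine Finset.sum_nonneg fun j hj => ?_
    have hj := (Finset.mem_Icc.1 hj).1
    have := S.seat j hj
    have := S.seatT j hj
    omega
  · obtain ⟨y, rfl⟩ : ∃ y, x = y + 1 := ⟨x - 1, by omega⟩
    have S := jointState hη y
    have he : η (y + 1) = 0 := (hη (y + 1)).resolve_right fun h => by
      simp [down_eq_zero_of_ball h] at hdown
    have hℓ : 1 ≤ ℓ := hk.trans hkℓ
    rcases down_cases he S.seat with h | ⟨m, hm, h1, h0, hd⟩
    · have := (h ℓ hℓ).2
      omega
    · obtain rfl : ℓ = m := by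
        by_contra hne
        rw [hd ℓ hℓ, if_neg hne] at hdown
        omega
      have hdT := down_eq_zero_of_ball (Tev_of_occupied hη he hℓ h1)
      have hone : ∀ j ∈ Icc 1 k, W η (y + 1) j + W (Tev η) (y + 1) j = 1 := fun j hj => by
        obtain ⟨hj, hjk⟩ := Finset.mem_Icc.1 hj
        rw [← S.below ℓ j hj (hjk.trans hkℓ) h1, W_succ, W_succ, up_eq_zero_of_empty he, hdT,
          S.up_Tev hη he hℓ h1 h0 j hj, hd j hj]
        ring
      rw [(jointState hη (y + 1)).xi_sub k, Finset.sum_congr rfl hone]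
      simp

end BBS
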